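/- Let (V, ω) be a 2n-dimensional symplectic vector space with n ≥ 3 and let G be the subgroup of GL(V) preserving ω^k for some fixed 0 < k < n. Then the identity component of G is contained in Sp(V, ω), the group of linear maps preserving ω. -/

import Mathlib

set_option synthInstance.maxHeartbeats 1000000
set_option maxHeartbeats 1000000

noncomputable section

open ExteriorAlgebra

/-- The value of an exterior 2-form on two vectors, obtained by contracting twice. -/
def formEval {V : Type*} [AddCommGroup V] [Module ℝ V]
    (x : ExteriorAlgebra ℝ (Module.Dual ℝ V)) (u v : V) : ℝ :=
  algebraMapInv
    (CliffordAlgebra.contractLeft (Module.Dual.eval ℝ V v)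
      (CliffordAlgebra.contractLeft (Module.Dual.eval ℝ V u) x))

/-- Pullback of forms by a linear map. -/
def pullback {V : Type*} [AddCommGroup V] [Module ℝ V] (T : V →ₗ[ℝ] V) :
    ExteriorAlgebra ℝ (Module.Dual ℝ V) →ₐ[ℝ] ExteriorAlgebra ℝ (Module.Dual ℝ V) :=
  ExteriorAlgebra.map T.dualMap

section Lefschetz

variable {V : Type*} [AddCommGroup V] [Module ℝ V]

/-- Interior product. -/
def ctr (u : V) : ExteriorAlgebra ℝ (Module.Dual ℝ V) →ₗ[ℝ] ExteriorAlgebra ℝ (Module.Dual ℝ V) :=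
  CliffordAlgebra.contractLeft (Module.Dual.eval ℝ V u)

theorem ctr_ι_mul (u : V) (a : Module.Dual ℝ V) (x : ExteriorAlgebra ℝ (Module.Dual ℝ V)) :
    ctr u (ι ℝ a * x) = a u • x - ι ℝ a * ctr u x :=
  CliffordAlgebra.contractLeft_ι_mul (Q := (0 : QuadraticForm ℝ (Module.Dual ℝ V))) _ _ _

theorem ctr_algebraMap (u : V) (r : ℝ) : 
    ctr u (algebraMap ℝ (ExteriorAlgebra ℝ (Module.Dual ℝ V)) r) = 0 :=
  CliffordAlgebra.contractLeft_algebraMap (Q := (0 : QuadraticForm ℝ (Module.Dual ℝ V))) _ _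

theorem two_induction {C : ExteriorAlgebra ℝ (Module.Dual ℝ V) → Prop}
    (h : ∀ a b : Module.Dual ℝ V, C (ι ℝ a * ι ℝ b))
    (ha : ∀ x y, C x → C y → C (x + y)) {w : ExteriorAlgebra ℝ (Module.Dual ℝ V)}
    (hw : w ∈ ⋀[ℝ]^2 (Module.Dual ℝ V)) : C w := by
  rw [exteriorPower, pow_two] at hw
  refine Submodule.mul_induction_on hw ?_ ha
  rintro _ ⟨a, rfl⟩ _ ⟨b, rfl⟩
  exact h a b

theorem ι_anti (a b : Module.Dual ℝ V) : ι ℝ a * ι ℝ b = - (ι ℝ b * ι ℝ a) := by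
  rw [eq_neg_iff_add_eq_zero]; exact ExteriorAlgebra.ι_add_mul_swap a b

theorem two_comm {w : ExteriorAlgebra ℝ (Module.Dual ℝ V)}
    (hw : w ∈ ⋀[ℝ]^2 (Module.Dual ℝ V)) (x : ExteriorAlgebra ℝ (Module.Dual ℝ V)) :
    Commute w x := by
  induction x using ExteriorAlgebra.induction with
  | algebraMap r => exact (Algebra.commutes r w).symm
  | ι c =>
    refine two_induction (C := fun w => Commute w (ι ℝ c)) ?_ (fun _ _ h1 h2 => h1.add_left h2) hw
    intro a b
    change _ * _ = _ * _
    rw [mul_assoc, ι_anti b c, mul_neg, ← mul_assoc, ι_anti a c, neg_mul, neg_neg, mul_assoc]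
  | mul a b ha hb => exact ha.mul_right hb
  | add a b ha hb => exact ha.add_right hb

theorem ctr_two_mul {w : ExteriorAlgebra ℝ (Module.Dual ℝ V)}
    (hw : w ∈ ⋀[ℝ]^2 (Module.Dual ℝ V)) (u : V) (x : ExteriorAlgebra ℝ (Module.Dual ℝ V)) :
    ctr u (w * x) = ctr u w * x + w * ctr u x := by
  refine two_induction (C := fun w => ctr u (w * x) = ctr u w * x + w * ctr u x) ?_ ?_ hw
  · intro a b
    have hb : ctr u (ι ℝ b) = algebraMap ℝ _ (b u) := by
      have := ctr_ι_mul u b 1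
      rw [mul_one, ← map_one (algebraMap ℝ _), ctr_algebraMap, mul_zero, sub_zero] at this
      rw [this, map_one, Algebra.algebraMap_eq_smul_one]
    rw [mul_assoc, ctr_ι_mul, ctr_ι_mul, ctr_ι_mul, hb, sub_mul, mul_assoc, mul_sub, mul_assoc,
      ← Algebra.smul_def, smul_mul_assoc]
    abel
  · intro x y h1 h2
    simp only [add_mul, map_add, h1, h2]
    abel

theorem ctr_pow_succ {w : ExteriorAlgebra ℝ (Module.Dual ℝ V)}
    (hw : w ∈ ⋀[ℝ]^2 (Module.Dual ℝ V)) (u : V) (m : ℕ) :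
    ctr u (w ^ (m + 1)) = ((m : ℝ) + 1) • (ctr u w * w ^ m) := by
  induction m with
  | zero => simp
  | succ m ih =>
    rw [pow_succ', ctr_two_mul hw, ih, mul_smul_comm, ← mul_assoc, (two_comm hw (ctr u w)).eq,
      mul_assoc, ← pow_succ']
    push_cast
    module

theorem ctr_mem {p : ℕ} {x : ExteriorAlgebra ℝ (Module.Dual ℝ V)}
    (hx : x ∈ ⋀[ℝ]^(p + 1) (Module.Dual ℝ V)) (u : V) :
    ctr u x ∈ ⋀[ℝ]^p (Module.Dual ℝ V) := by
  induction p generalizing x with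
  | zero =>
    rw [exteriorPower, zero_add, pow_one] at hx
    obtain ⟨b, rfl⟩ := hx
    have := ctr_ι_mul u b 1
    rw [mul_one, ← map_one (algebraMap ℝ _), ctr_algebraMap, mul_zero, sub_zero] at this
    rw [this, exteriorPower, pow_zero, map_one]
    exact Submodule.smul_mem _ _ (Submodule.mem_one.2 ⟨1, map_one _⟩)
  | succ p ih =>
    rw [exteriorPower, pow_succ'] at hx
    refine Submodule.mul_induction_on hx ?_ ?_
    · rintro _ ⟨a, rfl⟩ y hy
      rw [ctr_ι_mul]
      refine Submodule.sub_mem _ (Submodule.smul_mem _ _ hy) ?_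
      rw [exteriorPower, pow_succ']
      exact Submodule.mul_mem_mul ⟨a, rfl⟩ (ih hy)
    · intro x y h1 h2
      rw [map_add]; exact add_mem h1 h2

variable {I : Type*} [Fintype I] (b : Module.Basis I ℝ V)

theorem euler {p : ℕ} {x : ExteriorAlgebra ℝ (Module.Dual ℝ V)}
    (hx : x ∈ ⋀[ℝ]^p (Module.Dual ℝ V)) :
    ∑ i, ι ℝ (b.coord i) * ctr (b i) x = (p : ℝ) • x := by
  induction p generalizing x with
  | zero =>
    rw [exteriorPower, pow_zero] at hx
    obtain ⟨r, rfl⟩ := Submodule.mem_one.1 hx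
    simp [ctr_algebraMap]
  | succ p ih =>
    rw [exteriorPower, pow_succ'] at hx
    refine Submodule.mul_induction_on hx ?_ ?_
    · rintro _ ⟨a, rfl⟩ y hy
      have ha : ∑ i, a (b i) • b.coord i = a := by
        apply b.ext; intro j
        simp [Finsupp.single_apply]
      have h1 : ∀ i, ι ℝ (b.coord i) * ctr (b i) (ι ℝ a * y) =
          ι ℝ (a (b i) • b.coord i) * y + ι ℝ a * (ι ℝ (b.coord i) * ctr (b i) y) := by
        intro i
        rw [ctr_ι_mul, mul_sub, ← mul_assoc, ι_anti _ a, map_smul, mul_smul_comm, smul_mul_assoc,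
          neg_mul, sub_neg_eq_add, mul_assoc]
      rw [Finset.sum_congr rfl (fun i _ => h1 i), Finset.sum_add_distrib, ← Finset.sum_mul,
        ← map_sum, ha, ← Finset.mul_sum, ih hy, mul_smul_comm]
      push_cast
      module
    · intro x y h1 h2
      simp only [map_add, mul_add, Finset.sum_add_distrib, h1, h2, smul_add]

theorem eq_zero_of_ctr [FiniteDimensional ℝ V] {p : ℕ} {x : ExteriorAlgebra ℝ (Module.Dual ℝ V)}
    (hx : x ∈ ⋀[ℝ]^(p + 1) (Module.Dual ℝ V)) (h : ∀ u : V, ctr u x = 0) : x = 0 := by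
  have := euler (Module.finBasis ℝ V) hx
  simp only [h, mul_zero, Finset.sum_const_zero] at this
  exact (smul_eq_zero.1 this.symm).resolve_left (by positivity)

theorem eq_zero_of_mul [FiniteDimensional ℝ V] {p : ℕ} {x : ExteriorAlgebra ℝ (Module.Dual ℝ V)}
    (hx : x ∈ ⋀[ℝ]^p (Module.Dual ℝ V)) (hp : p < Module.finrank ℝ V)
    (h : ∀ a : Module.Dual ℝ V, ι ℝ a * x = 0) : x = 0 := by
  have h1 := euler (Module.finBasis ℝ V) hx
  have h2 : ∀ i, ι ℝ ((Module.finBasis ℝ V).coord i) * ctr (Module.finBasis ℝ V i) x = x := by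
    intro i
    have := ctr_ι_mul (Module.finBasis ℝ V i) ((Module.finBasis ℝ V).coord i) x
    rw [h, map_zero] at this
    simpa using (sub_eq_zero.1 this.symm).symm
  simp only [h2, Finset.sum_const, Finset.card_univ, Fintype.card_fin] at h1
  rw [← Nat.cast_smul_eq_nsmul ℝ, ← sub_eq_zero, ← sub_smul] at h1
  refine (smul_eq_zero.1 h1).resolve_left ?_
  refine sub_ne_zero.2 ?_
  exact_mod_cast hp.ne'

theorem ctr_surj [FiniteDimensional ℝ V] {w : ExteriorAlgebra ℝ (Module.Dual ℝ V)}
    (hw : w ∈ ⋀[ℝ]^2 (Module.Dual ℝ V))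
    (hnd : ∀ u : V, (∀ v : V, formEval w u v = 0) → u = 0) (a : Module.Dual ℝ V) :
    ∃ u, ctr u w = ι ℝ a := by
  let A : V →ₗ[ℝ] Module.Dual ℝ V := ιInv ∘ₗ
    ((CliffordAlgebra.contractLeft (Q := (0 : QuadraticForm ℝ (Module.Dual ℝ V)))).flip w) ∘ₗ
      Module.Dual.eval ℝ V
  have hA : ∀ u, ι ℝ (A u) = ctr u w := by
    intro u
    have h := ctr_mem hw u
    rw [exteriorPower, pow_one] at h
    obtain ⟨c, hc⟩ := h
    change ι ℝ (ιInv (ctr u w)) = _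
    rw [← hc, ι_leftInverse]
  have hinj : Function.Injective A := by
    rw [injective_iff_map_eq_zero]
    intro u hu
    apply hnd
    intro v
    change algebraMapInv (ctr v (ctr u w)) = 0
    rw [← hA, hu, map_zero, map_zero, map_zero]
  obtain ⟨u, hu⟩ := (LinearMap.injective_iff_surjective_of_finrank_eq_finrank
    (Subspace.dual_finrank_eq (K := ℝ) (V := V)).symm).1 hinj a
  exact ⟨u, by rw [← hA, hu]⟩

theorem pow_mem_ext {w : ExteriorAlgebra ℝ (Module.Dual ℝ V)}
    (hw : w ∈ ⋀[ℝ]^2 (Module.Dual ℝ V)) (m : ℕ) : w ^ m ∈ ⋀[ℝ]^(2 * m) (Module.Dual ℝ V) := by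
  rw [exteriorPower, pow_mul]
  exact Submodule.pow_mem_pow _ hw m

theorem pow_ne [FiniteDimensional ℝ V] {n : ℕ} (hdim : Module.finrank ℝ V = 2 * n)
    {w : ExteriorAlgebra ℝ (Module.Dual ℝ V)}
    (hw : w ∈ ⋀[ℝ]^2 (Module.Dual ℝ V))
    (hnd : ∀ u : V, (∀ v : V, formEval w u v = 0) → u = 0) (m : ℕ) (hm : m ≤ n) : w ^ m ≠ 0 := by
  induction m with
  | zero => rw [pow_zero]; exact one_ne_zero
  | succ m ih =>
    intro h0
    apply ih (by omega)
    refine eq_zero_of_mul (pow_mem_ext hw m) (by omega) ?_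
    intro a
    obtain ⟨u, hu⟩ := ctr_surj hw hnd a
    have := ctr_pow_succ hw u m
    rw [h0, map_zero, hu] at this
    exact (smul_eq_zero.1 this.symm).resolve_left (by positivity)

theorem lefschetz [FiniteDimensional ℝ V] {n : ℕ} (hdim : Module.finrank ℝ V = 2 * n)
    {w : ExteriorAlgebra ℝ (Module.Dual ℝ V)}
    (hw : w ∈ ⋀[ℝ]^2 (Module.Dual ℝ V))
    (hnd : ∀ u : V, (∀ v : V, formEval w u v = 0) → u = 0) (p : ℕ) :
    ∀ m, m + p ≤ n → ∀ x ∈ ⋀[ℝ]^p (Module.Dual ℝ V), w ^ m * x = 0 → x = 0 := by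
  induction p with
  | zero =>
    intro m hm x hx h
    rw [exteriorPower, pow_zero] at hx
    obtain ⟨r, rfl⟩ := Submodule.mem_one.1 hx
    rw [← Algebra.commutes, ← Algebra.smul_def] at h
    rw [(smul_eq_zero.1 h).resolve_right (pow_ne hdim hw hnd m (by omega)), map_zero]
  | succ p ih =>
    intro m hm x hx h
    refine eq_zero_of_ctr hx ?_
    intro u
    refine ih (m + 1) (by omega) _ (ctr_mem hx u) ?_
    have h1 : ctr u (w ^ (m + 1) * x) = ctr u (w ^ (m + 1)) * x + w ^ (m + 1) * ctr u x := by
      clear h hm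
      induction m + 1 with
      | zero => 
        have : ctr u (1 : ExteriorAlgebra ℝ (Module.Dual ℝ V)) = 0 := by
          rw [← map_one (algebraMap ℝ _), ctr_algebraMap]
        simp [this]
      | succ m ih => 
        rw [pow_succ', mul_assoc, ctr_two_mul hw, ih, ctr_two_mul hw]
        noncomm_ring
    rw [ctr_pow_succ hw, smul_mul_assoc, mul_assoc, h, mul_zero, smul_zero, zero_add,
      pow_succ', mul_assoc, h, mul_zero, map_zero] at h1
    rw [pow_succ']
    exact h1.symm

end Lefschetz

section Cont

variable {A : Type*} [Ring A] [Algebra ℝ A]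

/-- Finite combinations of continuous scalar functions with constant vectors. -/
def goodSet (A : Type*) [Ring A] [Algebra ℝ A] : Set (ℝ → A) :=
  {g | ∃ (c : ℝ → ℝ) (a : A), ContinuousOn c (Set.Icc 0 1) ∧ g = fun t => c t • a}

/-- Span of `goodSet`. -/
def good (A : Type*) [Ring A] [Algebra ℝ A] : Submodule ℝ (ℝ → A) := Submodule.span ℝ (goodSet A)

theorem good_mul {f g : ℝ → A} (hf : f ∈ good A) (hg : g ∈ good A) : f * g ∈ good A := by
  have h : good A * good A ≤ good A := by
    rw [good, Submodule.span_mul_span]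
    apply Submodule.span_mono
    rintro _ ⟨_, ⟨c, a, hc, rfl⟩, _, ⟨d, b, hd, rfl⟩, rfl⟩
    refine ⟨fun t => c t * d t, a * b, hc.mul hd, ?_⟩
    funext t
    exact smul_mul_smul_comm _ _ _ _
  exact h (Submodule.mul_mem_mul hf hg)

theorem good_smul {c : ℝ → ℝ} (hc : ContinuousOn c (Set.Icc 0 1)) (a : A) :
    (fun t => c t • a) ∈ good A := Submodule.subset_span ⟨c, a, hc, rfl⟩

theorem good_const (a : A) : (fun _ => a) ∈ good A := by
  simpa using good_smul (c := fun _ => 1) continuousOn_const a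

theorem good_pow {f : ℝ → A} (hf : f ∈ good A) (m : ℕ) : f ^ m ∈ good A := by
  induction m with
  | zero => rw [pow_zero]; exact good_const 1
  | succ m ih => rw [pow_succ]; exact good_mul ih hf

theorem good_cont {g : ℝ → A} (hg : g ∈ good A) (f : A →ₗ[ℝ] ℝ) :
    ContinuousOn (fun t => f (g t)) (Set.Icc 0 1) := by
  induction hg using Submodule.span_induction with
  | mem x hx =>
    obtain ⟨c, a, hc, rfl⟩ := hx
    simp only [map_smul, smul_eq_mul]
    exact hc.mul continuousOn_const
  | zero => simpa using continuousOn_const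
  | add x y _ _ hx hy => simpa only [Pi.add_apply, map_add] using ContinuousOn.fun_add hx hy
  | smul r x _ hx => 
    simp only [Pi.smul_apply, map_smul, smul_eq_mul]
    exact continuousOn_const.mul hx

end Cont

theorem pullback_good {V : Type*} [NormedAddCommGroup V] [NormedSpace ℝ V] [FiniteDimensional ℝ V]
    (γ : ℝ → V →L[ℝ] V) (hγcont : ContinuousOn γ (Set.Icc 0 1))
    {w : ExteriorAlgebra ℝ (Module.Dual ℝ V)} (hw : w ∈ ⋀[ℝ]^2 (Module.Dual ℝ V)) :
    (fun t => pullback (γ t).toLinearMap w) ∈ good (ExteriorAlgebra ℝ (Module.Dual ℝ V)) := by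
  have h1 : ∀ a : Module.Dual ℝ V, (fun t => pullback (γ t).toLinearMap (ι ℝ a)) ∈
      good (ExteriorAlgebra ℝ (Module.Dual ℝ V)) := by
    intro a
    let b := Module.finBasis ℝ V
    have h2 : (fun t => pullback (γ t).toLinearMap (ι ℝ a)) =
        ∑ i, fun t => a (γ t (b i)) • ι ℝ (b.coord i) := by
      funext t
      rw [Finset.sum_apply, pullback, ExteriorAlgebra.map_apply_ι]
      simp only [← map_smul]
      rw [← map_sum]
      congr 1
      apply b.ext; intro j
      simp [Finsupp.single_apply]
    rw [h2]
    refine Submodule.sum_mem _ fun i _ => good_smul ?_ _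
    have ha : Continuous a := LinearMap.continuous_of_finiteDimensional a
    exact ha.comp_continuousOn (hγcont.clm_apply continuousOn_const)
  refine two_induction (C := fun w => (fun t => pullback (γ t).toLinearMap w) ∈
    good (ExteriorAlgebra ℝ (Module.Dual ℝ V))) ?_ ?_ hw
  · intro a b
    simp only [map_mul]
    exact good_mul (h1 a) (h1 b)
  · intro x y hx hy
    simp only [map_add]
    exact add_mem hx hy

theorem pullback_mem {V : Type*} [AddCommGroup V] [Module ℝ V] (T : V →ₗ[ℝ] V)
    {w : ExteriorAlgebra ℝ (Module.Dual ℝ V)} (hw : w ∈ ⋀[ℝ]^2 (Module.Dual ℝ V)) :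
    pullback T w ∈ ⋀[ℝ]^2 (Module.Dual ℝ V) := by
  refine two_induction (C := fun w => pullback T w ∈ ⋀[ℝ]^2 (Module.Dual ℝ V)) ?_ ?_ hw
  · intro a b
    rw [map_mul, pullback, ExteriorAlgebra.map_apply_ι, ExteriorAlgebra.map_apply_ι,
      exteriorPower, pow_two]
    exact Submodule.mul_mem_mul ⟨_, rfl⟩ ⟨_, rfl⟩
  · intro x y hx hy
    rw [map_add]; exact add_mem hx hy

/-- The algebra of exterior forms. -/
abbrev EA (V : Type*) [AddCommGroup V] [Module ℝ V] := ExteriorAlgebra ℝ (Module.Dual ℝ V)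

theorem stmt19 {V : Type*} [NormedAddCommGroup V] [NormedSpace ℝ V] [FiniteDimensional ℝ V]
    (n k : ℕ) (hn : 3 ≤ n) (hdim : Module.finrank ℝ V = 2 * n)
    (hk0 : 0 < k) (hkn : k < n)
    (ω : ExteriorAlgebra ℝ (Module.Dual ℝ V))
    (hω2 : ω ∈ ⋀[ℝ]^2 (Module.Dual ℝ V))
    (hnd : ∀ u : V, (∀ v : V, formEval ω u v = 0) → u = 0)
    (T : V →L[ℝ] V)
    -- `T` lies in the identity component of `G = {S ∈ GL(V) : S*(ω^k) = ω^k}` :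
    (γ : ℝ → V →L[ℝ] V)
    (hγcont : ContinuousOn γ (Set.Icc 0 1))
    (hγ0 : γ 0 = ContinuousLinearMap.id ℝ V)
    (hγ1 : γ 1 = T)
    (hγG : ∀ t ∈ Set.Icc (0 : ℝ) 1,
      Function.Bijective (γ t) ∧ pullback (γ t).toLinearMap (ω ^ k) = ω ^ k) :
    pullback T.toLinearMap ω = ω := by
  have hω := fun x => two_comm hω2 x
  let α : ℝ → (EA V) := fun t => pullback (γ t).toLinearMap ω
  have hα : α ∈ good (EA V) := pullback_good γ hγcont hω2
  have hα2 : ∀ t, α t ∈ ⋀[ℝ]^2 (Module.Dual ℝ V) := fun t => pullback_mem _ hω2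
  let S : ℝ → (EA V) := fun t => ∑ i ∈ Finset.range k, α t ^ i * ω ^ (k - 1 - i)
  have hS : S ∈ good (EA V) := by
    have : S = ∑ i ∈ Finset.range k, α ^ i * (fun _ => ω ^ (k - 1 - i)) := by
      funext t; simp [S, Finset.sum_apply]
    rw [this]
    exact Submodule.sum_mem _ fun i _ => good_mul (good_pow hα i) (good_const _)
  let L : (EA V) → (⋀[ℝ]^2 (Module.Dual ℝ V)) →ₗ[ℝ] (EA V) := fun s =>
    (LinearMap.mulRight ℝ s) ∘ₗ (⋀[ℝ]^2 (Module.Dual ℝ V)).subtype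
  have hSω : ∀ t, α t = ω → S t = (k : ℝ) • ω ^ (k - 1) := by
    intro t ht
    have : ∀ i ∈ Finset.range k, α t ^ i * ω ^ (k - 1 - i) = ω ^ (k - 1) := by
      intro i hi
      rw [ht, ← pow_add]
      congr 1
      have := Finset.mem_range.1 hi
      omega
    simp only [S]
    rw [Finset.sum_congr rfl this, Finset.sum_const, Finset.card_range, Nat.cast_smul_eq_nsmul]
  have hinj : LinearMap.ker (L ((k : ℝ) • ω ^ (k - 1))) = ⊥ := by
    rw [LinearMap.ker_eq_bot']
    rintro ⟨x, hx⟩ h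
    have h' : x * ((k : ℝ) • ω ^ (k - 1)) = 0 := h
    rw [mul_smul_comm, ← ((hω x).pow_left (k - 1)).eq] at h'
    have h2 := (smul_eq_zero.1 h').resolve_left (by positivity)
    have := lefschetz hdim hω2 hnd 2 (k - 1) (by omega) x hx h2
    exact Subtype.ext this
  obtain ⟨R, hR⟩ := LinearMap.exists_leftInverse_of_injective _ hinj
  let D : ℝ → ℝ := fun t => LinearMap.det (R ∘ₗ L (S t))
  have hD1 : ∀ t, α t = ω → D t = 1 := by
    intro t ht
    simp only [D]
    rw [hSω t ht, hR, LinearMap.det_id]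
  have hD0 : ∀ t ∈ Set.Icc (0 : ℝ) 1, α t ≠ ω → D t = 0 := by
    intro t ht hne
    by_contra hdet
    apply hne
    have hk : (α t - ω) * S t = 0 := by
      have h := (two_comm (hα2 t) ω).mul_geom_sum₂ k
      have h2 : α t ^ k = ω ^ k := by
        simp only [α]; rw [← map_pow]; exact (hγG t ht).2
      rw [h2, sub_self] at h
      exact h
    have hu : IsUnit (LinearMap.det (R ∘ₗ L (S t))) := isUnit_iff_ne_zero.2 hdet
    have hker := LinearMap.ker_eq_bot'.1
      (LinearMap.ker_eq_bot.2 ((Module.End.isUnit_iff _).1 ((LinearMap.isUnit_iff_isUnit_det _).2 hu)).1)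
      ⟨α t - ω, sub_mem (hα2 t) hω2⟩ (by
        change R ((α t - ω) * S t) = 0
        rw [hk, map_zero])
    exact sub_eq_zero.1 (congrArg Subtype.val hker)
  have hDc : ContinuousOn D (Set.Icc 0 1) := by
    let b := Module.finBasis ℝ (⋀[ℝ]^2 (Module.Dual ℝ V))
    have hDm : D = fun t => ∑ σ : Equiv.Perm _, ((Equiv.Perm.sign σ : ℤ) : ℝ) *
        ∏ i, b.coord (σ i) (R ((b i : (EA V)) * S t)) := by
      funext t
      simp only [D]
      rw [← LinearMap.det_toMatrix b, Matrix.det_apply']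
      simp [LinearMap.toMatrix_apply, L]
    rw [hDm]
    refine continuousOn_finsetSum _ fun σ _ => continuousOn_const.mul
      (continuousOn_finsetProd _ fun i _ => ?_)
    exact good_cont hS (b.coord (σ i) ∘ₗ R ∘ₗ LinearMap.mulLeft ℝ (b i : (EA V)))
  have h0 : α 0 = ω := by
    simp only [α]
    rw [hγ0]
    have : (ContinuousLinearMap.id ℝ V).toLinearMap.dualMap = LinearMap.id := by
      ext; rfl
    rw [pullback, this, ExteriorAlgebra.map_id]
    rfl
  by_contra hne
  have h1 : α 1 ≠ ω := by
    simp only [α]; rw [hγ1]; exact hne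
  have hiv := intermediate_value_Icc' (zero_le_one' ℝ) hDc
  rw [hD1 0 h0, hD0 1 (by simp) h1] at hiv
  obtain ⟨t, ht, hDt⟩ := hiv (show (1/2 : ℝ) ∈ Set.Icc 0 1 by norm_num)
  by_cases h : α t = ω
  · rw [hD1 t h] at hDt; norm_num at hDt
  · rw [hD0 t ht h] at hDt; norm_num at hDt
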